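/- arXiv:2410.06382 — 6 statements merged into one kernel-verified Lean document; each statement's English description precedes it below -/
import Mathlib

section
/- Strong duality for the Benders subproblem: if the tasks are coverable and ȳ_p ≥ 0 for all p ∈ P, then the BSP attains an optimal solution, the dual BSP attains an optimal solution, and the two optimal values are equal. -/
open Finset

/-- Feasibility for the Benders subproblem (BSP). -/
def BSPFeasible {P K : Type*} [Fintype P] [Fintype K]
    (Δ : P → Type*) [∀ p, Fintype (Δ p)]
    (a : (p : P) → Δ p → K → ℝ) (ybar : P → ℝ)
    (x : (p : P) → Δ p → ℝ) (v : P → ℝ) : Prop :=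
  (∀ p (δ : Δ p), 0 ≤ x p δ) ∧ (∀ p, 0 ≤ v p) ∧
  (∀ p, ∑ δ : Δ p, x p δ ≤ ybar p + v p) ∧
  (∀ k : K, 1 ≤ ∑ p : P, ∑ δ : Δ p, a p δ k * x p δ)

/-- Feasibility for the dual of the Benders subproblem. -/
def DualBSPFeasible {P K : Type*} [Fintype P] [Fintype K]
    (Δ : P → Type*) [∀ p, Fintype (Δ p)]
    (a : (p : P) → Δ p → K → ℝ) (cE : ℝ)
    (θ : P → ℝ) (lam : K → ℝ) : Prop :=
  (∀ p (δ : Δ p), θ p + ∑ k : K, a p δ k * lam k ≤ 0) ∧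
  (∀ p, -cE ≤ θ p ∧ θ p ≤ 0) ∧
  (∀ k, 0 ≤ lam k)

/-- Weak duality for the Benders subproblem. -/
theorem bsp_weak_duality
    {P K : Type*} [Fintype P] [Fintype K]
    {Δ : P → Type*} [∀ p, Fintype (Δ p)]
    {a : (p : P) → Δ p → K → ℝ} {cE : ℝ} {ybar : P → ℝ}
    {x : (p : P) → Δ p → ℝ} {v : P → ℝ} {θ : P → ℝ} {lam : K → ℝ}
    (h : BSPFeasible Δ a ybar x v) (h' : DualBSPFeasible Δ a cE θ lam) :
    ∑ p : P, ybar p * θ p + ∑ k : K, lam k ≤ ∑ p : P, cE * v p := by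
  obtain ⟨hx, hv, hcap, hcover⟩ := h
  obtain ⟨hd, hθ, hlam⟩ := h'
  have h1 : ∑ k, lam k ≤ ∑ k, lam k * ∑ p, ∑ δ, a p δ k * x p δ :=
    sum_le_sum fun k _ => le_mul_of_one_le_right (hlam k) (hcover k)
  have h2 : ∑ k, lam k * ∑ p, ∑ δ, a p δ k * x p δ
      = ∑ p, ∑ δ, x p δ * ∑ k, a p δ k * lam k := by
    simp_rw [mul_sum]
    rw [sum_comm]
    refine sum_congr rfl fun p _ => ?_
    rw [sum_comm]
    exact sum_congr rfl fun δ _ => sum_congr rfl fun k _ => by ring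
  have h3 : ∑ p, ∑ δ, x p δ * ∑ k, a p δ k * lam k
      ≤ ∑ p, (cE * v p - ybar p * θ p) := by
    refine sum_le_sum fun p _ => ?_
    calc ∑ δ, x p δ * ∑ k, a p δ k * lam k
        ≤ ∑ δ, x p δ * (-θ p) :=
          sum_le_sum fun δ _ => mul_le_mul_of_nonneg_left (by linarith [hd p δ]) (hx p δ)
      _ = (∑ δ, x p δ) * (-θ p) := by rw [sum_mul]
      _ ≤ (ybar p + v p) * (-θ p) :=
          mul_le_mul_of_nonneg_right (hcap p) (by linarith [(hθ p).2])
      _ ≤ cE * v p - ybar p * θ p := by nlinarith [hv p, (hθ p).1]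
  rw [sum_sub_distrib] at h3
  linarith

/-- Capping the duty variables at one preserves the coverage of a task. -/
theorem one_le_sum_mul_min_one {ι : Type*} [Fintype ι] {a x : ι → ℝ}
    (ha : ∀ i, a i = 0 ∨ a i = 1) (hx : ∀ i, 0 ≤ x i) (h : 1 ≤ ∑ i, a i * x i) :
    1 ≤ ∑ i, a i * min (x i) 1 := by
  by_cases hi : ∃ i, a i = 1 ∧ 1 ≤ x i
  · obtain ⟨i, hai, hxi⟩ := hi
    have h0 : ∀ j ∈ univ, 0 ≤ a j * min (x j) 1 := fun j _ =>
      mul_nonneg (by rcases ha j with h | h <;> simp [h]) (le_min (hx j) zero_le_one)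
    simpa [hai, hxi] using single_le_sum h0 (mem_univ i)
  · push Not at hi
    convert h using 2 with i
    rcases ha i with h0 | h1
    · simp [h0]
    · rw [min_eq_left (hi i h1).le]

/-- If the tasks are coverable, the Benders subproblem attains an optimal solution. -/
theorem exists_bsp_optimal
    {P K : Type*} [Fintype P] [Fintype K]
    {Δ : P → Type*} [∀ p, Fintype (Δ p)]
    {a : (p : P) → Δ p → K → ℝ}
    (ha : ∀ (p : P) (δ : Δ p) (k : K), a p δ k = 0 ∨ a p δ k = 1)
    {cE : ℝ} (hcE : 0 ≤ cE) (ybar : P → ℝ)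
    (hcov : ∀ k : K, ∃ (p : P) (δ : Δ p), a p δ k = 1) :
    ∃ x v, BSPFeasible Δ a ybar x v ∧
      ∀ x' v', BSPFeasible Δ a ybar x' v' →
        ∑ p : P, cE * v p ≤ ∑ p : P, cE * v' p := by
  let s : Set ((p : P) → Δ p → ℝ) :=
    Set.Icc 0 1 ∩ {x | ∀ k, 1 ≤ ∑ p, ∑ δ, a p δ k * x p δ}
  have hclosed : IsClosed {x : (p : P) → Δ p → ℝ | ∀ k, 1 ≤ ∑ p, ∑ δ, a p δ k * x p δ} := by
    rw [Set.ofPred_forall]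
    exact isClosed_iInter fun k => isClosed_le continuous_const (by fun_prop)
  have hs : IsCompact s := isCompact_Icc.inter_right hclosed
  have hcap : ∀ x : (p : P) → Δ p → ℝ, (∀ p δ, 0 ≤ x p δ) →
      (∀ k, 1 ≤ ∑ p, ∑ δ, a p δ k * x p δ) → (fun p δ => min (x p δ) 1) ∈ s := by
    intro x hx hk
    refine ⟨⟨fun p δ => le_min (hx p δ) zero_le_one, fun p δ => min_le_right _ _⟩, fun k => ?_⟩
    have := one_le_sum_mul_min_one (ι := Σ p, Δ p) (a := fun i => a i.1 i.2 k)
      (x := fun i => x i.1 i.2) (fun i => ha _ _ _) (fun i => hx _ _)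
      (by simpa [Fintype.sum_sigma] using hk k)
    simpa [Fintype.sum_sigma] using this
  have hne : s.Nonempty := by
    refine ⟨_, hcap (fun _ _ => 1) (fun _ _ => zero_le_one) fun k => ?_⟩
    obtain ⟨p, δ, h⟩ := hcov k
    have h0 : ∀ i ∈ (univ : Finset (Σ p, Δ p)), 0 ≤ a i.1 i.2 k * 1 := fun i _ => by
      rcases ha i.1 i.2 k with h | h <;> simp [h]
    simpa [Fintype.sum_sigma, h] using single_le_sum h0 (mem_univ ⟨p, δ⟩)
  let v : ((p : P) → Δ p → ℝ) → P → ℝ := fun x p => max (∑ δ, x p δ - ybar p) 0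
  obtain ⟨x, hxs, hmin⟩ := hs.exists_isMinOn hne
    (f := fun x => ∑ p, cE * v x p) (by fun_prop)
  refine ⟨x, v x, ⟨fun p δ => hxs.1.1 p δ, fun p => le_max_right _ _, fun p => ?_, hxs.2⟩, ?_⟩
  · linarith [le_max_left (∑ δ, x p δ - ybar p) 0]
  · rintro x' v' ⟨hx', hv', hc', hk'⟩
    refine (hmin (hcap x' hx' hk')).trans (sum_le_sum fun p _ => ?_)
    refine mul_le_mul_of_nonneg_left (max_le ?_ (hv' p)) hcE
    have : ∑ δ, min (x' p δ) 1 ≤ ∑ δ, x' p δ := sum_le_sum fun δ _ => min_le_left _ _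
    linarith [hc' p]

theorem single_apply_nonneg {ι : Type*} [DecidableEq ι] {β : ι → Type*} [∀ i, Zero (β i)]
    [∀ i, Preorder (β i)] {i : ι} {t : β i} (ht : 0 ≤ t) (j : ι) :
    0 ≤ (Pi.single i t : ∀ j, β j) j :=
  Pi.single_nonneg.2 ht j

theorem nonneg_of_forall_le_add_mul {b c d : ℝ} (h : ∀ t, 0 ≤ t → c ≤ b + t * d) : 0 ≤ d := by
  by_contra! hd
  have ht := h ((|b - c| + 1) / -d) (by have := neg_pos.2 hd; positivity)
  have : (|b - c| + 1) / -d * d = -(|b - c| + 1) := by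
    rw [div_neg, neg_mul, div_mul_cancel₀ _ hd.ne]
  linarith [le_abs_self (b - c)]

/-- Lagrange multipliers for the Benders subproblem: a lower bound `c` on the value of the BSP
is witnessed by a dual feasible solution. -/
theorem exists_dualBSPFeasible_le
    {P K : Type*} [Fintype P] [Fintype K]
    {Δ : P → Type*} [∀ p, Fintype (Δ p)]
    {a : (p : P) → Δ p → K → ℝ}
    (ha : ∀ (p : P) (δ : Δ p) (k : K), a p δ k = 0 ∨ a p δ k = 1)
    {cE : ℝ} {ybar : P → ℝ} (hy : ∀ p, 0 ≤ ybar p)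
    (hcov : ∀ k : K, ∃ (p : P) (δ : Δ p), a p δ k = 1) {c : ℝ}
    (hc : ∀ x v, BSPFeasible Δ a ybar x v → c ≤ ∑ p : P, cE * v p) :
    ∃ θ lam, DualBSPFeasible Δ a cE θ lam ∧
      c ≤ ∑ p : P, ybar p * θ p + ∑ k : K, lam k := by
  classical
  let C (x : (p : P) → Δ p → ℝ) (v : P → ℝ) : Set ((P → ℝ) × (K → ℝ) × ℝ) :=
    {e | (∀ p, ∑ δ, x p δ - ybar p - v p < e.1 p) ∧
      (∀ k, 1 - ∑ p, ∑ δ, a p δ k * x p δ < e.2.1 k) ∧ ∑ p, cE * v p < e.2.2}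
  let S : Set ((P → ℝ) × (K → ℝ) × ℝ) :=
    {e | ∃ x v, (∀ p δ, 0 ≤ x p δ) ∧ (∀ p, 0 ≤ v p) ∧ e ∈ C x v}
  have hCopen : ∀ x v, IsOpen (C x v) := fun x v => by
    refine IsOpen.inter ?_ (IsOpen.inter ?_ ?_)
    · change IsOpen {e : (P → ℝ) × (K → ℝ) × ℝ | ∀ p, ∑ δ, x p δ - ybar p - v p < e.1 p}
      rw [Set.ofPred_forall]
      exact isOpen_iInter_of_finite fun p => isOpen_lt continuous_const (by fun_prop)
    · change IsOpen {e : (P → ℝ) × (K → ℝ) × ℝ |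
        ∀ k, 1 - ∑ p, ∑ δ, a p δ k * x p δ < e.2.1 k}
      rw [Set.ofPred_forall]
      exact isOpen_iInter_of_finite fun k => isOpen_lt continuous_const (by fun_prop)
    · change IsOpen {e : (P → ℝ) × (K → ℝ) × ℝ | ∑ p, cE * v p < e.2.2}
      exact isOpen_lt continuous_const (by fun_prop)
  have hSopen : IsOpen S := by
    refine isOpen_iff_mem_nhds.2 ?_
    rintro e ⟨x, v, hx, hv, he⟩
    exact Filter.mem_of_superset ((hCopen x v).mem_nhds he) fun e' he' => ⟨x, v, hx, hv, he'⟩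
  have hcomb : ∀ {s t r r' q q' : ℝ}, 0 ≤ s → 0 ≤ t → s + t = 1 → r < q → r' < q' →
      s * r + t * r' < s * q + t * q' := by
    intro s t r r' q q' hs ht hst h h'
    rcases hs.eq_or_lt with rfl | hs
    · obtain rfl : t = 1 := by linarith
      linarith
    · nlinarith [mul_pos hs (sub_pos.2 h), mul_nonneg ht (sub_nonneg.2 h'.le)]
  have hSconv : Convex ℝ S := by
    rintro e ⟨x, v, hx, hv, h1, h2, h3⟩ e' ⟨x', v', hx', hv', h1', h2', h3'⟩ s t hs ht hst
    refine ⟨fun p δ => s * x p δ + t * x' p δ, fun p => s * v p + t * v' p,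
      fun p δ => add_nonneg (mul_nonneg hs (hx p δ)) (mul_nonneg ht (hx' p δ)),
      fun p => add_nonneg (mul_nonneg hs (hv p)) (mul_nonneg ht (hv' p)),
      fun p => ?_, fun k => ?_, ?_⟩
    · change _ < s * e.1 p + t * e'.1 p
      convert hcomb hs ht hst (h1 p) (h1' p) using 1
      rw [sum_add_distrib, ← mul_sum, ← mul_sum]
      linear_combination ybar p * hst
    · change _ < s * e.2.1 k + t * e'.2.1 k
      convert hcomb hs ht hst (h2 k) (h2' k) using 1
      have : ∑ p, ∑ δ, a p δ k * (s * x p δ + t * x' p δ)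
          = s * ∑ p, ∑ δ, a p δ k * x p δ + t * ∑ p, ∑ δ, a p δ k * x' p δ := by
        simp_rw [mul_sum, ← sum_add_distrib]
        exact sum_congr rfl fun p _ => sum_congr rfl fun δ _ => by ring
      rw [this]
      linear_combination -hst
    · change _ < s * e.2.2 + t * e'.2.2
      convert hcomb hs ht hst h3 h3' using 1
      rw [mul_sum, mul_sum, ← sum_add_distrib]
      exact sum_congr rfl fun p _ => by ring
  have hnot : ((0, 0, c) : (P → ℝ) × (K → ℝ) × ℝ) ∉ S := by
    rintro ⟨x, v, hx, hv, h1, h2, h3⟩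
    refine (hc x v ⟨hx, hv, fun p => ?_, fun k => ?_⟩).not_gt h3
    · have := h1 p
      simp only [Pi.zero_apply] at this
      linarith
    · have := h2 k
      simp only [Pi.zero_apply] at this
      linarith
  obtain ⟨f, hf⟩ := geometric_hahn_banach_point_open hSconv hSopen hnot
  let α : P → ℝ := fun p => f (Pi.single p 1, 0, 0)
  let β : K → ℝ := fun k => f (0, Pi.single k 1, 0)
  let γ : ℝ := f (0, 0, 1)
  have hfe : ∀ u w z, f (u, w, z) = ∑ p, u p * α p + ∑ k, w k * β k + z * γ := by
    intro u w z
    have hdec : ((u, w, z) : (P → ℝ) × (K → ℝ) × ℝ) =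
        ∑ p, u p • ((Pi.single p 1, 0, 0) : (P → ℝ) × (K → ℝ) × ℝ) +
        ∑ k, w k • ((0, Pi.single k 1, 0) : (P → ℝ) × (K → ℝ) × ℝ) +
        z • ((0, 0, 1) : (P → ℝ) × (K → ℝ) × ℝ) := by
      ext i <;> simp [Prod.fst_sum, Prod.snd_sum, Finset.sum_apply, Pi.single_apply]
    rw [hdec]
    simp only [map_add, map_sum, map_smul, smul_eq_mul, α, β, γ]
  -- The multiplier of the objective is positive, by strict feasibility of a large solution.
  have hγ : 0 < γ := by
    let v : P → ℝ := fun p => ∑ _δ : Δ p, 2 + 1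
    have hmem : ((0, 0, max c (∑ p, cE * v p) + 1) : (P → ℝ) × (K → ℝ) × ℝ) ∈ S := by
      refine ⟨fun _ _ => 2, v, fun _ _ => zero_le_two,
        fun p => add_nonneg (sum_nonneg fun _ _ => zero_le_two) zero_le_one,
        fun p => ?_, fun k => ?_, ?_⟩
      · simp only [Pi.zero_apply, v]
        linarith [hy p]
      · obtain ⟨p, δ, h⟩ := hcov k
        have h0 : ∀ i ∈ (univ : Finset (Σ p, Δ p)), 0 ≤ a i.1 i.2 k * 2 := fun i _ => by
          rcases ha i.1 i.2 k with h | h <;> simp [h]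
        have := single_le_sum h0 (mem_univ ⟨p, δ⟩)
        rw [Fintype.sum_sigma] at this
        simp only [h, Pi.zero_apply] at this ⊢
        linarith
      · exact (le_max_right _ _).trans_lt (lt_add_one _)
    have := hf _ hmem
    rw [hfe, hfe] at this
    simp only [Pi.zero_apply, zero_mul, sum_const_zero, zero_add] at this
    nlinarith [le_max_left c (∑ p, cE * v p)]
  have hweak : ∀ (x : (p : P) → Δ p → ℝ) (v : P → ℝ) u w z, (∀ p δ, 0 ≤ x p δ) → (∀ p, 0 ≤ v p) →
      (∀ p, ∑ δ, x p δ - ybar p - v p ≤ u p) →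
      (∀ k, 1 - ∑ p, ∑ δ, a p δ k * x p δ ≤ w k) → ∑ p, cE * v p ≤ z →
      c * γ ≤ f (u, w, z) := by
    intro x v u w z hx hv h1 h2 h3
    have hlim : Filter.Tendsto (fun ε : ℝ => f ((u, w, z) + ε • (1, 1, 1)))
        (nhdsWithin 0 (Set.Ioi 0)) (nhds (f (u, w, z))) := by
      have : Continuous fun ε : ℝ => f ((u, w, z) + ε • (1, 1, 1)) := by fun_prop
      simpa using (this.tendsto 0).mono_left nhdsWithin_le_nhds
    refine ge_of_tendsto hlim (Filter.eventually_of_mem self_mem_nhdsWithin fun ε hε => ?_)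
    have hε : 0 < ε := hε
    have := hf ((u, w, z) + ε • (1, 1, 1)) ⟨x, v, hx, hv, fun p => ?_, fun k => ?_, ?_⟩
    · rw [hfe 0 0 c] at this
      simpa using this.le
    · simpa using (h1 p).trans_lt (lt_add_of_pos_right _ hε)
    · simpa using (h2 k).trans_lt (lt_add_of_pos_right _ hε)
    · simpa using h3.trans_lt (lt_add_of_pos_right _ hε)
  have hbase : c * γ ≤ f (-ybar, 1, 0) :=
    hweak 0 0 _ _ _ (by simp) (by simp) (by simp) (by simp) (by simp)
  have hα : ∀ p, 0 ≤ α p := fun p => by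
    refine nonneg_of_forall_le_add_mul (b := f (-ybar, 1, 0)) (c := c * γ) fun t ht => ?_
    rw [← smul_eq_mul t, ← map_smul, ← map_add]
    refine hweak 0 0 _ _ _ (by simp) (by simp) (fun q => ?_) (by simp) (by simp)
    have : (0 : P → ℝ) ≤ Pi.single p 1 := Pi.single_nonneg.2 zero_le_one
    simpa using mul_nonneg ht (this q)
  have hβ : ∀ k, 0 ≤ β k := fun k => by
    refine nonneg_of_forall_le_add_mul (b := f (-ybar, 1, 0)) (c := c * γ) fun t ht => ?_
    rw [← smul_eq_mul t, ← map_smul, ← map_add]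
    refine hweak 0 0 _ _ _ (by simp) (by simp) (by simp) (fun l => ?_) (by simp)
    have : (0 : K → ℝ) ≤ Pi.single k 1 := Pi.single_nonneg.2 zero_le_one
    simpa using mul_nonneg ht (this l)
  have hv : ∀ p, α p ≤ cE * γ := fun p => by
    have : 0 ≤ f (-Pi.single p 1, 0, cE) := by
      refine nonneg_of_forall_le_add_mul (b := f (-ybar, 1, 0)) (c := c * γ) fun t ht => ?_
      rw [← smul_eq_mul t, ← map_smul, ← map_add]
      refine hweak 0 (Pi.single p t) _ _ _ (by simp) (single_apply_nonneg ht)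
        (fun q => ?_) (by simp) ?_
      · by_cases h : q = p <;> simp [h]
      · simp [Pi.single_apply, mul_comm]
    rw [hfe] at this
    simp [Pi.single_apply] at this
    linarith
  have hx : ∀ p δ, ∑ k, a p δ k * β k ≤ α p := fun p δ => by
    have : 0 ≤ f (Pi.single p 1, -a p δ, 0) := by
      refine nonneg_of_forall_le_add_mul (b := f (-ybar, 1, 0)) (c := c * γ) fun t ht => ?_
      rw [← smul_eq_mul t, ← map_smul, ← map_add]
      have hcol : ∀ k, ∑ q, ∑ ε, a q ε k *
          (Pi.single p (Pi.single δ t) : (p : P) → Δ p → ℝ) q ε = t * a p δ k := fun k => by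
        rw [Fintype.sum_eq_single p fun q hq => by simp [hq],
          Fintype.sum_eq_single δ fun ε hε => by simp [hε]]
        simp [mul_comm]
      refine hweak (Pi.single p (Pi.single δ t)) 0 _ _ _ (fun q => ?_) (by simp) (fun q => ?_)
        (fun k => ?_) (by simp)
      · exact single_apply_nonneg (β := fun p => Δ p → ℝ) (Pi.single_nonneg.2 ht) q
      · rcases eq_or_ne q p with rfl | h
        · simp [add_comm]
        · simp [h]
      · rw [hcol]
        simp [sub_eq_add_neg]
    rw [hfe] at this
    simp [Pi.single_apply] at this
    linarith
  refine ⟨fun p => -(α p / γ), fun k => β k / γ, ⟨fun p δ => ?_, fun p => ⟨?_, ?_⟩, fun k => ?_⟩,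
    ?_⟩
  · have : ∑ k, a p δ k * (β k / γ) = (∑ k, a p δ k * β k) / γ := by
      rw [sum_div]
      exact sum_congr rfl fun k _ => by ring
    rw [this]
    linarith [div_le_div_of_nonneg_right (hx p δ) hγ.le]
  · exact neg_le_neg ((div_le_iff₀ hγ).2 (hv p))
  · exact neg_nonpos.2 (div_nonneg (hα p) hγ.le)
  · exact div_nonneg (hβ k) hγ.le
  · rw [hfe] at hbase
    have : ∑ p, ybar p * -(α p / γ) + ∑ k, β k / γ
        = (∑ p, (-ybar) p * α p + ∑ k, (1 : K → ℝ) k * β k + 0 * γ) / γ := by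
      rw [zero_mul, add_zero, add_div, sum_div, sum_div]
      congr 1 <;> exact sum_congr rfl fun _ _ => by simp; try ring
    rw [this]
    exact (le_div_iff₀ hγ).2 hbase

/-- Strong duality for the Benders subproblem: if the tasks are coverable and the
capacities are nonnegative, both the BSP and its dual attain optimal solutions, and the
two optimal values are equal. -/
theorem bsp_strong_duality
    {P K : Type*} [Fintype P] [Fintype K]
    (Δ : P → Type*) [∀ p, Fintype (Δ p)]
    (a : (p : P) → Δ p → K → ℝ)
    (ha : ∀ (p : P) (δ : Δ p) (k : K), a p δ k = 0 ∨ a p δ k = 1)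
    (cE : ℝ) (hcE : 0 < cE)
    (ybar : P → ℝ) (hy : ∀ p, 0 ≤ ybar p)
    (hcov : ∀ k : K, ∃ (p : P) (δ : Δ p), a p δ k = 1) :
    ∃ x v, BSPFeasible Δ a ybar x v ∧
      (∀ x' v', BSPFeasible Δ a ybar x' v' →
        ∑ p : P, cE * v p ≤ ∑ p : P, cE * v' p) ∧
      ∃ θ lam, DualBSPFeasible Δ a cE θ lam ∧
        (∀ θ' lam', DualBSPFeasible Δ a cE θ' lam' →
          ∑ p : P, ybar p * θ' p + ∑ k : K, lam' k ≤
            ∑ p : P, ybar p * θ p + ∑ k : K, lam k) ∧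
        ∑ p : P, ybar p * θ p + ∑ k : K, lam k = ∑ p : P, cE * v p := by
  obtain ⟨x, v, hxv, hopt⟩ := exists_bsp_optimal ha hcE.le ybar hcov
  obtain ⟨θ, lam, hd, hle⟩ := exists_dualBSPFeasible_le ha hy hcov hopt
  exact ⟨x, v, hxv, hopt, θ, lam, hd,
    fun θ' lam' h' => (bsp_weak_duality hxv h').trans hle, (bsp_weak_duality hxv hd).antisymm hle⟩
end

section
/- Boundedness of the dual feasible region: if the tasks are coverable, then every dual-BSP-feasible pair (θ, λ) satisfies 0 ≤ λ_k ≤ c_E for every k ∈ K; consequently, for every nonnegative capacity vector ȳ, the dual BSP objective value of any feasible (θ, λ) is at most c_E·|K|. -/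
open Finset

/-- Boundedness of the dual feasible region: if the tasks are coverable then every dual
feasible pair satisfies `0 ≤ λ_k ≤ c_E`, and for every nonnegative capacity vector the
dual objective value of any feasible pair is at most `c_E * |K|`. -/
theorem dual_bsp_bounded
    {P K : Type*} [Fintype P] [Fintype K]
    (Δ : P → Type*) [∀ p, Fintype (Δ p)]
    (a : (p : P) → Δ p → K → ℝ)
    (ha : ∀ (p : P) (δ : Δ p) (k : K), a p δ k = 0 ∨ a p δ k = 1)
    (cE : ℝ) (hcE : 0 < cE)
    (hcov : ∀ k : K, ∃ (p : P) (δ : Δ p), a p δ k = 1) :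
    (∀ θ lam, DualBSPFeasible Δ a cE θ lam →
      ∀ k : K, 0 ≤ lam k ∧ lam k ≤ cE) ∧
    (∀ ybar : P → ℝ, (∀ p, 0 ≤ ybar p) →
      ∀ θ lam, DualBSPFeasible Δ a cE θ lam →
        ∑ p : P, ybar p * θ p + ∑ k : K, lam k ≤ cE * (Fintype.card K : ℝ)) := by
  have hbound : ∀ θ lam, DualBSPFeasible Δ a cE θ lam → ∀ k : K, 0 ≤ lam k ∧ lam k ≤ cE := by
    rintro θ lam ⟨hduty, hθ, hlam⟩ k
    obtain ⟨p, δ, hk⟩ := hcov k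
    have hterm : a p δ k * lam k ≤ ∑ j : K, a p δ j * lam j :=
      Finset.single_le_sum (f := fun j => a p δ j * lam j)
        (fun j _ => mul_nonneg (by rcases ha p δ j with h | h <;> simp [h]) (hlam j))
        (Finset.mem_univ k)
    rw [hk, one_mul] at hterm
    exact ⟨hlam k, by linarith [hduty p δ, (hθ p).1]⟩
  refine ⟨hbound, fun ybar hy θ lam h => ?_⟩
  have hcap : ∑ p : P, ybar p * θ p ≤ 0 :=
    Finset.sum_nonpos fun p _ => mul_nonpos_of_nonneg_of_nonpos (hy p) (h.2.1 p).2
  have hsum : ∑ k : K, lam k ≤ ∑ _k : K, cE :=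
    Finset.sum_le_sum fun k _ => (hbound θ lam h k).2
  rw [Finset.sum_const, Finset.card_univ, nsmul_eq_mul, mul_comm] at hsum
  linarith
end

section
/- Validity of Benders optimality cuts: fix a scenario s ∈ S and let (θ, λ) satisfy the dual feasibility conditions for scenario s, namely θ_p + ∑_{k∈K_s} a_{pk}^{δs} λ_k ≤ 0 for every p ∈ P and δ ∈ Δ_p^s, −c_E ≤ θ_p ≤ 0 for every p ∈ P, and λ_k ≥ 0 for every k ∈ K_s. Then every feasible solution (x, v, y, z, η) of the recoverable-robust model satisfies ∑_{p∈P} θ_p y_p + ∑_{k∈K_s} λ_k ≤ η. -/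
open Finset

/-- Feasibility for the recoverable-robust tactical crew scheduling model. -/
def RRFeasible {P S M : Type*} [Fintype P] [Fintype S] [Fintype M]
    (K : S → Type*) [∀ s, Fintype (K s)]
    (Δ : (s : S) → P → Type*) [∀ s p, Fintype (Δ s p)]
    (a : (s : S) → (p : P) → Δ s p → K s → ℝ)
    (cE C Γ : ℝ) (e : M → P → ℝ) (E : M → ℝ)
    (x : (s : S) → (p : P) → Δ s p → ℝ) (v : S → P → ℝ)
    (y : P → ℕ) (z : P → ℝ) (η : ℝ) : Prop :=
  (∀ s p (δ : Δ s p), x s p δ = 0 ∨ x s p δ = 1) ∧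
  (∀ p, z p = 0 ∨ z p = 1) ∧
  (∀ p, (y p : ℝ) ≤ C * z p) ∧
  (∑ p : P, z p ≤ Γ) ∧
  (∀ m : M, ∑ p : P, e m p * (y p : ℝ) ≤ E m) ∧
  (∀ s, cE * ∑ p : P, v s p ≤ η) ∧
  (∀ s p, ∑ δ : Δ s p, x s p δ ≤ (y p : ℝ) + v s p) ∧
  (∀ s (k : K s), 1 ≤ ∑ p : P, ∑ δ : Δ s p, a s p δ k * x s p δ) ∧
  (∀ s p, 0 ≤ v s p)

/-- Validity of Benders optimality cuts: any pair `(θ, λ)` that is dual feasible for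
scenario `s` yields a cut satisfied by every feasible solution of the recoverable-robust
model. -/
theorem benders_cut_valid
    {P S M : Type*} [Fintype P] [Fintype S] [Fintype M]
    (K : S → Type*) [∀ s, Fintype (K s)]
    (Δ : (s : S) → P → Type*) [∀ s p, Fintype (Δ s p)]
    (a : (s : S) → (p : P) → Δ s p → K s → ℝ)
    (ha : ∀ s p (δ : Δ s p) (k : K s), a s p δ k = 0 ∨ a s p δ k = 1)
    (c : P → ℝ) (hc : ∀ p, 0 ≤ c p)
    (cE : ℝ) (hcE : 0 < cE)
    (C Γ : ℝ) (hC : 0 ≤ C) (hΓ : 0 ≤ Γ)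
    (e : M → P → ℝ) (E : M → ℝ)
    (s : S) (θ : P → ℝ) (lam : K s → ℝ)
    (hdual1 : ∀ p (δ : Δ s p), θ p + ∑ k : K s, a s p δ k * lam k ≤ 0)
    (hdual2 : ∀ p, -cE ≤ θ p ∧ θ p ≤ 0)
    (hdual3 : ∀ k, 0 ≤ lam k)
    (x : (s : S) → (p : P) → Δ s p → ℝ) (v : S → P → ℝ)
    (y : P → ℕ) (z : P → ℝ) (η : ℝ)
    (hfeas : RRFeasible K Δ a cE C Γ e E x v y z η) :
    ∑ p : P, θ p * (y p : ℝ) + ∑ k : K s, lam k ≤ η := by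
  obtain ⟨hx, -, -, -, -, hη, hcap, hcov, hv⟩ := hfeas
  have hx0 (p) (δ : Δ s p) : 0 ≤ x s p δ := by
    rcases hx s p δ with h | h <;> simp [h]
  have hlam : ∑ k, lam k ≤ ∑ p, ∑ δ, x s p δ * ∑ k, a s p δ k * lam k :=
    calc ∑ k, lam k ≤ ∑ k, lam k * ∑ p, ∑ δ, a s p δ k * x s p δ :=
          sum_le_sum fun k _ => le_mul_of_one_le_right (hdual3 k) (hcov s k)
      _ = ∑ p, ∑ δ, x s p δ * ∑ k, a s p δ k * lam k := by
          simp_rw [mul_sum]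
          rw [sum_comm]
          refine sum_congr rfl fun p _ => ?_
          rw [sum_comm]
          exact sum_congr rfl fun δ _ => sum_congr rfl fun k _ => by ring
  have hp (p) : ∑ δ, x s p δ * ∑ k, a s p δ k * lam k ≤ cE * v s p - θ p * y p :=
    calc ∑ δ, x s p δ * ∑ k, a s p δ k * lam k ≤ ∑ δ, x s p δ * -θ p :=
          sum_le_sum fun δ _ =>
            mul_le_mul_of_nonneg_left (by linarith [hdual1 p δ]) (hx0 p δ)
      _ = (∑ δ, x s p δ) * -θ p := by rw [sum_mul]
      _ ≤ (y p + v s p) * -θ p :=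
          mul_le_mul_of_nonneg_right (hcap s p) (neg_nonneg.2 (hdual2 p).2)
      _ ≤ cE * v s p - θ p * y p := by
          linarith [mul_le_mul_of_nonneg_right (hdual2 p).1 (hv s p)]
  have hsum := sum_le_sum fun p (_ : p ∈ univ) => hp p
  rw [sum_sub_distrib, ← mul_sum] at hsum
  linarith [hη s]
end

section
/- The Benders master problem is a relaxation: suppose for each scenario s ∈ S a finite set O_s of cuts is given, each cut o ∈ O_s being a pair (θ^{os}, λ^{os}) satisfying θ_p^{os} + ∑_{k∈K_s} a_{pk}^{δs} λ_k^{os} ≤ 0 for every p ∈ P and δ ∈ Δ_p^s, −c_E ≤ θ_p^{os} ≤ 0 for every p ∈ P, and λ_k^{os} ≥ 0 for every k ∈ K_s. Then for every feasible solution (x, v, y, z, η) of the recoverable-robust model, the triple (y, z, η) is feasible for the Benders master problem and has the same objective value ∑_{p∈P} c_p y_p + η; hence the optimal value of the Benders master problem is a lower bound on the optimal value of the recoverable-robust model. -/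
open Finset

/-- Feasibility for the Benders master problem (BMP), given for each scenario `s` a
finite set `O s` of cuts `(θ s o, lam s o)`. -/
def BMPFeasible {P S M : Type*} [Fintype P] [Fintype S] [Fintype M]
    (K : S → Type*) [∀ s, Fintype (K s)]
    (C Γ : ℝ) (e : M → P → ℝ) (E : M → ℝ)
    (O : S → Type*) [∀ s, Fintype (O s)]
    (θ : (s : S) → O s → P → ℝ) (lam : (s : S) → O s → K s → ℝ)
    (y : P → ℕ) (z : P → ℝ) (η : ℝ) : Prop :=
  (∀ p, z p = 0 ∨ z p = 1) ∧
  (∀ p, (y p : ℝ) ≤ C * z p) ∧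
  (∑ p : P, z p ≤ Γ) ∧
  (∀ m : M, ∑ p : P, e m p * (y p : ℝ) ≤ E m) ∧
  (∀ s (o : O s), ∑ p : P, θ s o p * (y p : ℝ) + ∑ k : K s, lam s o k ≤ η)

/-- Weak duality for one scenario: a dual feasible cut evaluated at a primal feasible point
is bounded by the cost of the excess duties. -/
theorem cut_le_excess_cost {P K : Type*} [Fintype P] [Fintype K]
    {Δ : P → Type*} [∀ p, Fintype (Δ p)]
    {a : (p : P) → Δ p → K → ℝ} {cE : ℝ} {θ : P → ℝ} {lam : K → ℝ}
    {x : (p : P) → Δ p → ℝ} {y v : P → ℝ}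
    (hdual : ∀ p (δ : Δ p), θ p + ∑ k, a p δ k * lam k ≤ 0)
    (hθ_lower : ∀ p, -cE ≤ θ p) (hθ_nonpos : ∀ p, θ p ≤ 0) (hlam : ∀ k, 0 ≤ lam k)
    (hx : ∀ p δ, 0 ≤ x p δ) (hcap : ∀ p, ∑ δ, x p δ ≤ y p + v p)
    (hcover : ∀ k, 1 ≤ ∑ p, ∑ δ, a p δ k * x p δ) (hv : ∀ p, 0 ≤ v p) :
    ∑ p, θ p * y p + ∑ k, lam k ≤ cE * ∑ p, v p := by
  have hlam_le : ∑ k, lam k ≤ ∑ p, ∑ δ, x p δ * ∑ k, a p δ k * lam k := by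
    calc ∑ k, lam k ≤ ∑ k, lam k * ∑ p, ∑ δ, a p δ k * x p δ :=
          Finset.sum_le_sum fun k _ => le_mul_of_one_le_right (hlam k) (hcover k)
      _ = ∑ p, ∑ δ, x p δ * ∑ k, a p δ k * lam k := by
          simp only [Finset.mul_sum]
          rw [Finset.sum_comm]
          refine Finset.sum_congr rfl fun p _ => ?_
          rw [Finset.sum_comm]
          exact Finset.sum_congr rfl fun δ _ => Finset.sum_congr rfl fun k _ => by ring
  have hterm : ∀ p, θ p * y p + ∑ δ, x p δ * ∑ k, a p δ k * lam k ≤ cE * v p := by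
    intro p
    have hprice : ∑ δ, x p δ * ∑ k, a p δ k * lam k ≤ (∑ δ, x p δ) * -θ p := by
      rw [Finset.sum_mul]
      exact Finset.sum_le_sum fun δ _ =>
        mul_le_mul_of_nonneg_left (by linarith [hdual p δ]) (hx p δ)
    nlinarith [mul_le_mul_of_nonneg_right (hcap p) (neg_nonneg.2 (hθ_nonpos p)),
      mul_le_mul_of_nonneg_right (hθ_lower p) (hv p)]
  calc ∑ p, θ p * y p + ∑ k, lam k
      ≤ ∑ p, (θ p * y p + ∑ δ, x p δ * ∑ k, a p δ k * lam k) := by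
        rw [Finset.sum_add_distrib]
        linarith
    _ ≤ ∑ p, cE * v p := Finset.sum_le_sum fun p _ => hterm p
    _ = cE * ∑ p, v p := (Finset.mul_sum ..).symm

/-- The Benders master problem is a relaxation: if every cut is dual feasible for its
scenario, then every feasible solution of the recoverable-robust model yields a feasible
BMP solution with the same objective value; hence any lower bound on the BMP objective is
a lower bound on the objective of the recoverable-robust model. -/
theorem bmp_is_relaxation
    {P S M : Type*} [Fintype P] [Fintype S] [Fintype M]
    (K : S → Type*) [∀ s, Fintype (K s)]
    (Δ : (s : S) → P → Type*) [∀ s p, Fintype (Δ s p)]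
    (a : (s : S) → (p : P) → Δ s p → K s → ℝ)
    (ha : ∀ s p (δ : Δ s p) (k : K s), a s p δ k = 0 ∨ a s p δ k = 1)
    (c : P → ℝ) (hc : ∀ p, 0 ≤ c p)
    (cE : ℝ) (hcE : 0 < cE)
    (C Γ : ℝ) (hC : 0 ≤ C) (hΓ : 0 ≤ Γ)
    (e : M → P → ℝ) (E : M → ℝ)
    (O : S → Type*) [∀ s, Fintype (O s)]
    (θ : (s : S) → O s → P → ℝ) (lam : (s : S) → O s → K s → ℝ)
    (hdual1 : ∀ s (o : O s) p (δ : Δ s p),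
      θ s o p + ∑ k : K s, a s p δ k * lam s o k ≤ 0)
    (hdual2 : ∀ s (o : O s) p, -cE ≤ θ s o p ∧ θ s o p ≤ 0)
    (hdual3 : ∀ s (o : O s) k, 0 ≤ lam s o k)
    (x : (s : S) → (p : P) → Δ s p → ℝ) (v : S → P → ℝ)
    (y : P → ℕ) (z : P → ℝ) (η : ℝ)
    (hfeas : RRFeasible K Δ a cE C Γ e E x v y z η) :
    BMPFeasible K C Γ e E O θ lam y z η ∧
    ∀ L : ℝ,
      (∀ (y' : P → ℕ) (z' : P → ℝ) (η' : ℝ),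
          BMPFeasible K C Γ e E O θ lam y' z' η' →
          L ≤ ∑ p : P, c p * (y' p : ℝ) + η') →
      L ≤ ∑ p : P, c p * (y p : ℝ) + η := by
  obtain ⟨hx, hz, hyz, hzΓ, hrost, hη, hcap, hcover, hv⟩ := hfeas
  have hbmp : BMPFeasible K C Γ e E O θ lam y z η := by
    refine ⟨hz, hyz, hzΓ, hrost, fun s o => le_trans ?_ (hη s)⟩
    refine cut_le_excess_cost (hdual1 s o) (fun p => (hdual2 s o p).1)
      (fun p => (hdual2 s o p).2) (hdual3 s o) (fun p δ => ?_) (hcap s) (hcover s) (hv s)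
    rcases hx s p δ with h | h <;> simp [h]
  exact ⟨hbmp, fun L hL => hL y z η hbmp⟩
end

section
/- Correctness of the Benders algorithm at convergence (first phase): suppose every cut (θ^{os}, λ^{os}) in the Benders master problem satisfies the dual feasibility conditions of its scenario s (θ_p^{os} + ∑_{k∈K_s} a_{pk}^{δs} λ_k^{os} ≤ 0 for all p ∈ P, δ ∈ Δ_p^s; −c_E ≤ θ_p^{os} ≤ 0; λ_k^{os} ≥ 0). Let (ȳ, z̄, η̄) be an optimal solution of the Benders master problem, and suppose that for every scenario s ∈ S the scenario-s Benders subproblem with capacities ȳ has an optimal solution (x̄^s, v̄^s) whose objective value satisfies c_E ∑_{p∈P} v̄_p^s ≤ η̄. Then (x̄, v̄, ȳ, z̄, η̄) is an optimal solution of the continuous relaxation of the recoverable-robust model obtained by replacing the constraints x_p^{δs} ∈ {0,1} with x_p^{δs} ≥ 0. -/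
open Finset

/-- Feasibility for the continuous relaxation of the recoverable-robust model, in which
the binary constraints `x ∈ {0,1}` are replaced by `x ≥ 0`. -/
def RRRelaxedFeasible {P S M : Type*} [Fintype P] [Fintype S] [Fintype M]
    (K : S → Type*) [∀ s, Fintype (K s)]
    (Δ : (s : S) → P → Type*) [∀ s p, Fintype (Δ s p)]
    (a : (s : S) → (p : P) → Δ s p → K s → ℝ)
    (cE C Γ : ℝ) (e : M → P → ℝ) (E : M → ℝ)
    (x : (s : S) → (p : P) → Δ s p → ℝ) (v : S → P → ℝ)
    (y : P → ℕ) (z : P → ℝ) (η : ℝ) : Prop :=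
  (∀ s p (δ : Δ s p), 0 ≤ x s p δ) ∧
  (∀ p, z p = 0 ∨ z p = 1) ∧
  (∀ p, (y p : ℝ) ≤ C * z p) ∧
  (∑ p : P, z p ≤ Γ) ∧
  (∀ m : M, ∑ p : P, e m p * (y p : ℝ) ≤ E m) ∧
  (∀ s, cE * ∑ p : P, v s p ≤ η) ∧
  (∀ s p, ∑ δ : Δ s p, x s p δ ≤ (y p : ℝ) + v s p) ∧
  (∀ s (k : K s), 1 ≤ ∑ p : P, ∑ δ : Δ s p, a s p δ k * x s p δ) ∧
  (∀ s p, 0 ≤ v s p)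

/-- Feasibility for the scenario-`s` Benders subproblem with capacities `ybar`. -/
def ScenarioBSPFeasible {P S : Type*} [Fintype P]
    (K : S → Type*) [∀ s, Fintype (K s)]
    (Δ : (s : S) → P → Type*) [∀ s p, Fintype (Δ s p)]
    (a : (s : S) → (p : P) → Δ s p → K s → ℝ)
    (s : S) (ybar : P → ℝ)
    (x : (p : P) → Δ s p → ℝ) (v : P → ℝ) : Prop :=
  (∀ p (δ : Δ s p), 0 ≤ x p δ) ∧ (∀ p, 0 ≤ v p) ∧
  (∀ p, ∑ δ : Δ s p, x p δ ≤ ybar p + v p) ∧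
  (∀ k : K s, 1 ≤ ∑ p : P, ∑ δ : Δ s p, a s p δ k * x p δ)

/-- Weak duality for the scenario subproblem: a dual feasible cut underestimates the
recourse cost of every feasible primal solution. -/
theorem ScenarioBSPFeasible.cut_le {P S : Type*} [Fintype P]
    {K : S → Type*} [∀ s, Fintype (K s)]
    {Δ : (s : S) → P → Type*} [∀ s p, Fintype (Δ s p)]
    {a : (s : S) → (p : P) → Δ s p → K s → ℝ}
    {s : S} {y : P → ℝ} {x : (p : P) → Δ s p → ℝ} {v : P → ℝ}
    (h : ScenarioBSPFeasible K Δ a s y x v)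
    {cE : ℝ} {θ : P → ℝ} {lam : K s → ℝ}
    (hcover : ∀ p (δ : Δ s p), θ p + ∑ k, a s p δ k * lam k ≤ 0)
    (hθ : ∀ p, -cE ≤ θ p ∧ θ p ≤ 0) (hlam : ∀ k, 0 ≤ lam k) :
    ∑ p, θ p * y p + ∑ k, lam k ≤ cE * ∑ p, v p := by
  obtain ⟨hx, hv, hcap, hcov⟩ := h
  have hlam_le : ∑ k, lam k ≤ ∑ p, (cE * v p - θ p * y p) := by
    calc ∑ k, lam k ≤ ∑ k, lam k * ∑ p, ∑ δ, a s p δ k * x p δ :=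
          sum_le_sum fun k _ => le_mul_of_one_le_right (hlam k) (hcov k)
      _ = ∑ p, ∑ δ, x p δ * ∑ k, a s p δ k * lam k := by
          simp only [mul_sum]
          rw [sum_comm]
          refine sum_congr rfl fun p _ => ?_
          rw [sum_comm]
          exact sum_congr rfl fun δ _ => sum_congr rfl fun k _ => by ring
      _ ≤ ∑ p, ∑ δ, x p δ * -θ p :=
          sum_le_sum fun p _ => sum_le_sum fun δ _ =>
            mul_le_mul_of_nonneg_left (by linarith [hcover p δ]) (hx p δ)
      _ ≤ ∑ p, (cE * v p - θ p * y p) := by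
          refine sum_le_sum fun p _ => ?_
          rw [← sum_mul]
          have h₁ := mul_le_mul_of_nonneg_right (hcap p) (neg_nonneg.2 (hθ p).2)
          have h₂ := mul_le_mul_of_nonneg_right (hθ p).1 (hv p)
          linarith
  rw [sum_sub_distrib, ← mul_sum] at hlam_le
  linarith

/-- Correctness of the Benders algorithm at convergence (first phase): if all cuts are
dual feasible, `(ȳ, z̄, η̄)` is BMP optimal, and for each scenario the BSP with
capacities `ȳ` has an optimal solution with objective value at most `η̄`, then the
combined solution is optimal for the continuous relaxation of the recoverable-robust
model. -/
theorem benders_convergence_correct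
    {P S M : Type*} [Fintype P] [Fintype S] [Fintype M]
    (K : S → Type*) [∀ s, Fintype (K s)]
    (Δ : (s : S) → P → Type*) [∀ s p, Fintype (Δ s p)]
    (a : (s : S) → (p : P) → Δ s p → K s → ℝ)
    (ha : ∀ s p (δ : Δ s p) (k : K s), a s p δ k = 0 ∨ a s p δ k = 1)
    (c : P → ℝ) (hc : ∀ p, 0 ≤ c p)
    (cE : ℝ) (hcE : 0 < cE)
    (C Γ : ℝ) (hC : 0 ≤ C) (hΓ : 0 ≤ Γ)
    (e : M → P → ℝ) (E : M → ℝ)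
    (O : S → Type*) [∀ s, Fintype (O s)]
    (θ : (s : S) → O s → P → ℝ) (lam : (s : S) → O s → K s → ℝ)
    (hdual1 : ∀ s (o : O s) p (δ : Δ s p),
      θ s o p + ∑ k : K s, a s p δ k * lam s o k ≤ 0)
    (hdual2 : ∀ s (o : O s) p, -cE ≤ θ s o p ∧ θ s o p ≤ 0)
    (hdual3 : ∀ s (o : O s) k, 0 ≤ lam s o k)
    (ybar : P → ℕ) (zbar : P → ℝ) (ηbar : ℝ)
    (hbmp : BMPFeasible K C Γ e E O θ lam ybar zbar ηbar)
    (hbmpopt : ∀ (y' : P → ℕ) (z' : P → ℝ) (η' : ℝ),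
      BMPFeasible K C Γ e E O θ lam y' z' η' →
      ∑ p : P, c p * (ybar p : ℝ) + ηbar ≤ ∑ p : P, c p * (y' p : ℝ) + η')
    (xbar : (s : S) → (p : P) → Δ s p → ℝ) (vbar : S → P → ℝ)
    (hbsp : ∀ s, ScenarioBSPFeasible K Δ a s (fun p => (ybar p : ℝ))
      (xbar s) (vbar s))
    (hbspopt : ∀ s (x' : (p : P) → Δ s p → ℝ) (v' : P → ℝ),
      ScenarioBSPFeasible K Δ a s (fun p => (ybar p : ℝ)) x' v' →
      ∑ p : P, cE * vbar s p ≤ ∑ p : P, cE * v' p)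
    (hbspobj : ∀ s, cE * ∑ p : P, vbar s p ≤ ηbar) :
    RRRelaxedFeasible K Δ a cE C Γ e E xbar vbar ybar zbar ηbar ∧
    ∀ (x : (s : S) → (p : P) → Δ s p → ℝ) (v : S → P → ℝ)
      (y : P → ℕ) (z : P → ℝ) (η : ℝ),
      RRRelaxedFeasible K Δ a cE C Γ e E x v y z η →
      ∑ p : P, c p * (ybar p : ℝ) + ηbar ≤ ∑ p : P, c p * (y p : ℝ) + η := by
  obtain ⟨hz, hyz, hΓz, hE, -⟩ := hbmp
  refine ⟨⟨fun s => (hbsp s).1, hz, hyz, hΓz, hE, hbspobj, fun s => (hbsp s).2.2.1,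
    fun s => (hbsp s).2.2.2, fun s => (hbsp s).2.1⟩, ?_⟩
  rintro x v y z η ⟨hx, hz', hyz', hΓz', hE', hη, hcap, hcov, hv⟩
  refine hbmpopt y z η ⟨hz', hyz', hΓz', hE', fun s o => le_trans ?_ (hη s)⟩
  have hfeas : ScenarioBSPFeasible K Δ a s (fun p => (y p : ℝ)) (x s) (v s) :=
    ⟨hx s, hv s, hcap s, hcov s⟩
  exact hfeas.cut_le (hdual1 s o) (hdual2 s o) (hdual3 s o)
end

section
/- Validity of the flow-based valid inequality: fix a scenario s ∈ S and suppose there is a finite directed acyclic graph with node set K_s ∪ {σ, τ} and arc set A_s, a subset A_s(t) ⊆ A_s, and a subset P(t) ⊆ P, together with, for each p ∈ P and δ ∈ Δ_p^s, a directed path π_p^{δs} from σ to τ such that: (i) π_p^{δs} visits every task k ∈ K_s with a_{pk}^{δs} = 1; (ii) if π_p^{δs} traverses an arc of A_s(t), then p ∈ P(t); and (iii) every directed path from σ to τ traverses at most one arc of A_s(t). Let V_t^s denote the optimal value of the flow LP on this graph with objective ∑_{a∈A_s(t)} f_a. Then every feasible solution (x, v, y, z, η) of the recoverable-robust model satisfies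 ∑_{p∈P(t)} y_p + η/c_E ≥ V_t^s. -/
open Finset

/-- A directed path (walk) from `σ` to `τ`, given as the nonempty list of its arcs. -/
def IsSTPath {N A : Type*} (tl hd : A → N) (σ τ : N) (π : List A) : Prop :=
  π ≠ [] ∧ (∀ b, π.head? = some b → tl b = σ) ∧
  (∀ b, π.getLast? = some b → hd b = τ) ∧
  List.Chain' (fun b b' => hd b = tl b') π

/-- Feasibility for the flow LP. -/
def FlowFeasible {N A : Type*} [Fintype A] [DecidableEq N]
    (tl hd : A → N) (KS : Finset N) (f : A → ℝ) : Prop :=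
  (∀ b, 0 ≤ f b) ∧
  (∀ k ∈ KS, ∑ b ∈ Finset.univ.filter (fun b => tl b = k), f b =
    ∑ b ∈ Finset.univ.filter (fun b => hd b = k), f b) ∧
  (∀ k ∈ KS, 1 ≤ ∑ b ∈ Finset.univ.filter (fun b => tl b = k), f b)

theorem List.sum_count_eq_countP {A : Type*} [DecidableEq A] (s : Finset A) (l : List A) :
    ∑ b ∈ s, l.count b = l.countP (fun b => decide (b ∈ s)) := by
  induction l with
  | nil => simp
  | cons c l ih =>
    simp [List.count_cons, List.countP_cons, Finset.sum_add_distrib, ih]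

theorem IsSTPath.map_tail_append {N A : Type*} {tl hd : A → N} {σ τ : N} {π : List A}
    (h : IsSTPath tl hd σ τ π) : π.map tl ++ [τ] = σ :: π.map hd := by
  obtain ⟨hne, hhead, hlast, hchain⟩ := h
  induction π generalizing σ with
  | nil => exact absurd rfl hne
  | cons b l ih =>
    have hb : tl b = σ := hhead b rfl
    cases l with
    | nil =>
      have hτ : hd b = τ := hlast b rfl
      simp [hb, hτ]
    | cons b' l =>
      have hchain' := List.isChain_cons_cons.1 hchain
      have := ih (σ := hd b) (by simp) (by simpa using hchain'.1.symm)
        (by simpa using hlast) hchain'.2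
      rw [List.map_cons, List.cons_append, this, hb]
      rfl

/-- A path leaves every node other than its endpoints as often as it enters it. -/
theorem IsSTPath.count_map_eq {N A : Type*} [DecidableEq N] {tl hd : A → N} {σ τ k : N}
    {π : List A} (h : IsSTPath tl hd σ τ π) (hσ : σ ≠ k) (hτ : τ ≠ k) :
    (π.map tl).count k = (π.map hd).count k := by
  have := congrArg (List.count k) h.map_tail_append
  simpa [List.count_append, List.count_cons, hσ, hτ] using this

theorem IsSTPath.count_map_pos {N A : Type*} [DecidableEq N] {tl hd : A → N} {σ τ k : N}
    {π : List A} (h : IsSTPath tl hd σ τ π) (hσ : σ ≠ k) (hτ : τ ≠ k)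
    (hk : ∃ b ∈ π, tl b = k ∨ hd b = k) : 0 < (π.map tl).count k := by
  obtain ⟨b, hb, hbk | hbk⟩ := hk
  · exact List.count_pos_iff.2 (List.mem_map.2 ⟨b, hb, hbk⟩)
  · rw [h.count_map_eq hσ hτ]
    exact List.count_pos_iff.2 (List.mem_map.2 ⟨b, hb, hbk⟩)

theorem List.sum_count_filter_eq_count_map {N A : Type*} [Fintype A] [DecidableEq A]
    [DecidableEq N] (g : A → N) (k : N) (l : List A) :
    ∑ b ∈ Finset.univ.filter (fun b => g b = k), l.count b = (l.map g).count k := by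
  rw [List.sum_count_eq_countP, List.count, List.countP_map]
  refine List.countP_congr fun b _ => ?_
  simp

/-- The superposition of the paths `π p δ` with weights `x p δ`. -/
noncomputable def pathFlow {P A : Type*} [Fintype P] [DecidableEq A] {D : P → Type*}
    [∀ p, Fintype (D p)] (π : (p : P) → D p → List A) (x : (p : P) → D p → ℝ) (b : A) : ℝ :=
  ∑ p, ∑ δ, x p δ * ((π p δ).count b : ℝ)

theorem sum_pathFlow {P A : Type*} [Fintype P] [DecidableEq A] {D : P → Type*}
    [∀ p, Fintype (D p)] (π : (p : P) → D p → List A) (x : (p : P) → D p → ℝ) (B : Finset A) :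
    ∑ b ∈ B, pathFlow π x b = ∑ p, ∑ δ, x p δ * ((∑ b ∈ B, (π p δ).count b : ℕ) : ℝ) := by
  unfold pathFlow
  rw [Finset.sum_comm]
  refine Finset.sum_congr rfl fun p _ => ?_
  rw [Finset.sum_comm]
  refine Finset.sum_congr rfl fun δ _ => ?_
  rw [Nat.cast_sum, Finset.mul_sum]

/-- Validity of the flow-based valid inequality: under the stated path assumptions for
scenario `s`, every feasible solution of the recoverable-robust model satisfies
`∑_{p ∈ P(t)} y_p + η / c_E ≥ V_t^s`, where `V_t^s` is the optimal value of the flow LP.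
The node set of the scenario DAG is `K s ⊕ Bool`, with `Sum.inr false` the source `σ` and
`Sum.inr true` the sink `τ`. -/
theorem flow_valid_inequality
    {P S M : Type*} [Fintype P] [Fintype S] [Fintype M] [DecidableEq P]
    (K : S → Type*) [∀ s, Fintype (K s)] [∀ s, DecidableEq (K s)]
    (Δ : (s : S) → P → Type*) [∀ s p, Fintype (Δ s p)]
    (a : (s : S) → (p : P) → Δ s p → K s → ℝ)
    (ha : ∀ s p (δ : Δ s p) (k : K s), a s p δ k = 0 ∨ a s p δ k = 1)
    (c : P → ℝ) (hc : ∀ p, 0 ≤ c p)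
    (cE : ℝ) (hcE : 0 < cE)
    (C Γ : ℝ) (hC : 0 ≤ C) (hΓ : 0 ≤ Γ)
    (e : M → P → ℝ) (E : M → ℝ)
    -- the scenario and its directed acyclic graph
    (s : S) {A : Type*} [Fintype A] [DecidableEq A]
    (tl hd : A → (K s ⊕ Bool))
    (hsource : ∀ b : A, hd b ≠ Sum.inr false)
    (hsink : ∀ b : A, tl b ≠ Sum.inr true)
    (rank : (K s ⊕ Bool) → ℕ) (hacyclic : ∀ b : A, rank (tl b) < rank (hd b))
    (At : Finset A) (Pt : Finset P)
    -- for each template and duty, a source-sink path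
    (π : (p : P) → Δ s p → List A)
    (hpath : ∀ p (δ : Δ s p),
      IsSTPath tl hd (Sum.inr false) (Sum.inr true) (π p δ))
    -- (i) the path of duty δ visits every task covered by δ
    (hvisit : ∀ p (δ : Δ s p) (k : K s), a s p δ k = 1 →
      ∃ b ∈ π p δ, tl b = Sum.inl k ∨ hd b = Sum.inl k)
    -- (ii) if the path of a duty of template p traverses an arc of At, then p ∈ Pt
    (hPt : ∀ p (δ : Δ s p), (∃ b ∈ π p δ, b ∈ At) → p ∈ Pt)
    -- (iii) every source-sink path traverses at most one arc of At
    (honce : ∀ ρ : List A,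
      IsSTPath tl hd (Sum.inr false) (Sum.inr true) ρ →
      ρ.countP (fun b => decide (b ∈ At)) ≤ 1)
    (x : (s : S) → (p : P) → Δ s p → ℝ) (v : S → P → ℝ)
    (y : P → ℕ) (z : P → ℝ) (η : ℝ)
    (hfeas : RRFeasible K Δ a cE C Γ e E x v y z η) :
    sInf {r : ℝ | ∃ f,
        FlowFeasible tl hd (Finset.univ.filter (fun n : K s ⊕ Bool => n.isLeft)) f ∧
        r = ∑ b ∈ At, f b} ≤
      ∑ p ∈ Pt, (y p : ℝ) + η / cE := by
  obtain ⟨hx, -, -, -, -, hη, hxy, hcover, hv⟩ := hfeas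
  have hx0 : ∀ p (δ : Δ s p), 0 ≤ x s p δ := fun p δ => by
    rcases hx s p δ with h | h <;> simp [h]
  have hflow_nonneg : ∀ b, 0 ≤ pathFlow π (x s) b := fun b =>
    Finset.sum_nonneg fun p _ => Finset.sum_nonneg fun δ _ =>
      mul_nonneg (hx0 p δ) (Nat.cast_nonneg _)
  have hbalance := fun (k : K s) p (δ : Δ s p) =>
    (hpath p δ).count_map_eq (k := Sum.inl k) Sum.inr_ne_inl Sum.inr_ne_inl
  have hflow : FlowFeasible tl hd (Finset.univ.filter (fun n : K s ⊕ Bool => n.isLeft))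
      (pathFlow π (x s)) := by
    refine ⟨hflow_nonneg, fun n hn => ?_, fun n hn => ?_⟩
    all_goals
      obtain ⟨k, rfl⟩ := Sum.isLeft_iff.1 (Finset.mem_filter.1 hn).2
    · simp only [sum_pathFlow, List.sum_count_filter_eq_count_map, hbalance]
    · refine (hcover s k).trans ?_
      simp only [sum_pathFlow, List.sum_count_filter_eq_count_map]
      refine Finset.sum_le_sum fun p _ => Finset.sum_le_sum fun δ _ => ?_
      rw [mul_comm]
      refine mul_le_mul_of_nonneg_left ?_ (hx0 p δ)
      rcases ha s p δ k with h | h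
      · rw [h]
        exact Nat.cast_nonneg _
      · rw [h]
        exact Nat.one_le_cast.2 <|
          (hpath p δ).count_map_pos Sum.inr_ne_inl Sum.inr_ne_inl (hvisit p δ k h)
  have hobj : ∑ b ∈ At, pathFlow π (x s) b ≤ ∑ p ∈ Pt, ∑ δ, x s p δ := by
    rw [sum_pathFlow, ← Finset.sum_subset (Finset.subset_univ Pt)]
    · refine Finset.sum_le_sum fun p _ => Finset.sum_le_sum fun δ _ => ?_
      refine mul_le_of_le_one_right (hx0 p δ) ?_
      rw [List.sum_count_eq_countP]
      exact_mod_cast honce _ (hpath p δ)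
    · intro p _ hp
      refine Finset.sum_eq_zero fun δ _ => ?_
      rw [List.sum_count_eq_countP, List.countP_eq_zero.2, Nat.cast_zero, mul_zero]
      intro b hb hbt
      exact hp (hPt p δ ⟨b, hb, of_decide_eq_true hbt⟩)
  have hbdd : BddBelow {r : ℝ | ∃ f,
      FlowFeasible tl hd (Finset.univ.filter (fun n : K s ⊕ Bool => n.isLeft)) f ∧
      r = ∑ b ∈ At, f b} := by
    refine ⟨0, ?_⟩
    rintro _ ⟨f, hf, rfl⟩
    exact Finset.sum_nonneg fun b _ => hf.1 b
  calc _ ≤ ∑ b ∈ At, pathFlow π (x s) b := csInf_le hbdd ⟨_, hflow, rfl⟩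
    _ ≤ ∑ p ∈ Pt, ∑ δ, x s p δ := hobj
    _ ≤ ∑ p ∈ Pt, ((y p : ℝ) + v s p) := Finset.sum_le_sum fun p _ => hxy s p
    _ = ∑ p ∈ Pt, (y p : ℝ) + ∑ p ∈ Pt, v s p := Finset.sum_add_distrib
    _ ≤ ∑ p ∈ Pt, (y p : ℝ) + ∑ p, v s p := by
      gcongr
      · exact fun p _ _ => hv s p
      · exact Finset.subset_univ Pt
    _ ≤ ∑ p ∈ Pt, (y p : ℝ) + η / cE := by
      gcongr
      rw [le_div_iff₀ hcE, mul_comm]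
      exact hη s
end
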